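/- Let X ⊂ ℝ^d (d ≥ 2) be an open set, let γ ∈ C¹(X) with γ > 0 on X, let Γ, σ_a ∈ C¹(X) with Γ > 0 and σ_a > 0 on X, and let u₁, u₂ ∈ C²(X) satisfy −∇·(γ∇u_j) + σ_a u_j = 0 in X for j = 1, 2, with u₁(x) > 0 for all x ∈ X. Define the internal data H_j := Γ σ_a u_j for j = 1, 2, and μ := √γ/(Γσ_a). Then, at every point of X, ∇·( μ² H₁² ∇(H₂/H₁) ) = 0; that is, μ² satisfies the transport equation −∇·(μ² β) = 0 with the data-determined vector field β = H₁² ∇(H₂/H₁). (This is the key transport equation derived in the proof of the paper's Theorem 2.4, showing that the internal data from two illuminations determine μ = √γ/(Γσ_a) through a transport equation with known vector field.) -/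

import Mathlib

open MeasureTheory

noncomputable section

/-- Euclidean space ℝ^d. -/
abbrev Euc (d : ℕ) : Type := EuclideanSpace ℝ (Fin d)

/-- Divergence of a vector field on Euclidean space: `∇·F = ∑ i ∂Fᵢ/∂xᵢ`. -/
def vdiv {d : ℕ} (F : Euc d → Euc d) (x : Euc d) : ℝ :=
  ∑ i : Fin d, fderiv ℝ (fun y => F y i) x (EuclideanSpace.single i (1 : ℝ))

/-- Laplacian `Δf = ∇·(∇f)`. -/
def lap {d : ℕ} (f : Euc d → ℝ) (x : Euc d) : ℝ :=
  vdiv (fun y => gradient f y) x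

/-- L² norm of `f` over `X`: `(∫_X f² dx)^{1/2}`. -/
def L2norm {d : ℕ} (X : Set (Euc d)) (f : Euc d → ℝ) : ℝ :=
  (∫ x in X, (f x) ^ 2) ^ (1 / 2 : ℝ)

/-- H¹ norm of `f` over `X`: `(∫_X (f² + |∇f|²) dx)^{1/2}`. -/
def H1norm {d : ℕ} (X : Set (Euc d)) (f : Euc d → ℝ) : ℝ :=
  (∫ x in X, ((f x) ^ 2 + ‖gradient f x‖ ^ 2)) ^ (1 / 2 : ℝ)

/-- `X` has smooth boundary: it is the strict sublevel set of a smooth defining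
function whose differential does not vanish on the boundary. -/
def HasSmoothBoundary {d : ℕ} (X : Set (Euc d)) : Prop :=
  ∃ φ : Euc d → ℝ, ContDiff ℝ (⊤ : ℕ∞) φ ∧ X = {x | φ x < 0} ∧
    ∀ x ∈ frontier X, fderiv ℝ φ x ≠ 0

theorem grad_apply_aux {d : ℕ} (f : Euc d → ℝ) (y : Euc d) (i : Fin d) :
    gradient f y i = fderiv ℝ f y (EuclideanSpace.single i (1 : ℝ)) := by
  have h : inner ℝ (gradient f y) (EuclideanSpace.single i (1 : ℝ))
      = fderiv ℝ f y (EuclideanSpace.single i (1 : ℝ)) := by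
    unfold gradient
    exact InnerProductSpace.toDual_symm_apply
  rw [← h, EuclideanSpace.inner_single_right]
  simp

/-- key transport equation in the proof of paper Thm 2.4: with
internal data Hⱼ = Γσₐuⱼ and μ = √γ/(Γσₐ), the quantity μ² satisfies the transport
equation ∇·(μ²β) = 0 with data-determined vector field β = H₁²∇(H₂/H₁). -/
theorem mu_transport_equation
    (d : ℕ) (hd : 2 ≤ d) (X : Set (Euc d)) (hXopen : IsOpen X)
    (γ : Euc d → ℝ) (hγ : ContDiffOn ℝ 1 γ X) (hγpos : ∀ x ∈ X, 0 < γ x)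
    (Γ σa : Euc d → ℝ) (hΓ : ContDiffOn ℝ 1 Γ X) (hσa : ContDiffOn ℝ 1 σa X)
    (hΓpos : ∀ x ∈ X, 0 < Γ x) (hσapos : ∀ x ∈ X, 0 < σa x)
    (u₁ u₂ : Euc d → ℝ) (hu₁ : ContDiffOn ℝ 2 u₁ X) (hu₂ : ContDiffOn ℝ 2 u₂ X)
    (hu₁pos : ∀ x ∈ X, 0 < u₁ x)
    (heq₁ : ∀ x ∈ X, -vdiv (fun y => γ y • gradient u₁ y) x + σa x * u₁ x = 0)
    (heq₂ : ∀ x ∈ X, -vdiv (fun y => γ y • gradient u₂ y) x + σa x * u₂ x = 0) :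
    -- with Hⱼ = Γσₐuⱼ and μ = √γ/(Γσₐ):  ∇·(μ² H₁² ∇(H₂/H₁)) = 0 on X
    ∀ x ∈ X,
      vdiv (fun y =>
        ((Real.sqrt (γ y) / (Γ y * σa y)) ^ 2 * (Γ y * σa y * u₁ y) ^ 2) •
          gradient (fun z => (Γ z * σa z * u₂ z) / (Γ z * σa z * u₁ z)) y) x = 0 := by
  intro x hx
  have hXn : ∀ y ∈ X, X ∈ nhds y := fun y hy => hXopen.mem_nhds hy
  have d1 : ∀ y ∈ X, DifferentiableAt ℝ u₁ y := fun y hy =>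
    (hu₁.contDiffAt (hXn y hy)).differentiableAt (by norm_num)
  have d2 : ∀ y ∈ X, DifferentiableAt ℝ u₂ y := fun y hy =>
    (hu₂.contDiffAt (hXn y hy)).differentiableAt (by norm_num)
  have dγ : DifferentiableAt ℝ γ x :=
    (hγ.contDiffAt (hXn x hx)).differentiableAt (by norm_num)
  have key : ∀ u : Euc d → ℝ, ContDiffOn ℝ 2 u X → ∀ i : Fin d,
      DifferentiableAt ℝ (fun y => γ y * fderiv ℝ u y (EuclideanSpace.single i (1 : ℝ))) x := by
    intro u hu i
    have h1 : DifferentiableAt ℝ (fderiv ℝ u) x :=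
      ((hu.contDiffAt (hXn x hx)).fderiv_right (m := 1) (by norm_num)).differentiableAt
        (by norm_num)
    exact dγ.mul (h1.clm_apply (differentiableAt_const _))
  have e1 := heq₁ x hx
  have e2 := heq₂ x hx
  simp only [vdiv, PiLp.smul_apply, smul_eq_mul, grad_apply_aux] at e1 e2 ⊢
  have main : ∀ i : Fin d, fderiv ℝ (fun y =>
        ((Real.sqrt (γ y) / (Γ y * σa y)) ^ 2 * (Γ y * σa y * u₁ y) ^ 2) *
          fderiv ℝ (fun z => (Γ z * σa z * u₂ z) / (Γ z * σa z * u₁ z)) y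
            (EuclideanSpace.single i (1 : ℝ))) x (EuclideanSpace.single i (1 : ℝ))
      = u₁ x * fderiv ℝ (fun y => γ y * fderiv ℝ u₂ y (EuclideanSpace.single i (1 : ℝ))) x
            (EuclideanSpace.single i (1 : ℝ))
        - u₂ x * fderiv ℝ (fun y => γ y * fderiv ℝ u₁ y (EuclideanSpace.single i (1 : ℝ))) x
            (EuclideanSpace.single i (1 : ℝ)) := by
    intro i
    have hev : (fun y =>
        ((Real.sqrt (γ y) / (Γ y * σa y)) ^ 2 * (Γ y * σa y * u₁ y) ^ 2) *
          fderiv ℝ (fun z => (Γ z * σa z * u₂ z) / (Γ z * σa z * u₁ z)) y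
            (EuclideanSpace.single i (1 : ℝ))) =ᶠ[nhds x]
        (fun y => u₁ y * (γ y * fderiv ℝ u₂ y (EuclideanSpace.single i (1 : ℝ)))
          - u₂ y * (γ y * fderiv ℝ u₁ y (EuclideanSpace.single i (1 : ℝ)))) := by
      filter_upwards [hXn x hx] with y hy
      have hq : (fun z => (Γ z * σa z * u₂ z) / (Γ z * σa z * u₁ z)) =ᶠ[nhds y]
          (fun z => u₂ z * (u₁ z)⁻¹) := by
        filter_upwards [hXn y hy] with z hz
        rw [← div_eq_mul_inv]
        exact mul_div_mul_left _ _ (mul_pos (hΓpos z hz) (hσapos z hz)).ne'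
      have h1 := (hu₁pos y hy).ne'
      have h2 := (hΓpos y hy).ne'
      have h3 := (hσapos y hy).ne'
      have hinv : HasFDerivAt (fun z => (u₁ z)⁻¹) ((-(u₁ y ^ 2)⁻¹) • fderiv ℝ u₁ y) y :=
        (hasDerivAt_inv h1).comp_hasFDerivAt y (d1 y hy).hasFDerivAt
      rw [hq.fderiv_eq, ((d2 y hy).hasFDerivAt.fun_mul hinv).fderiv,
        div_pow, Real.sq_sqrt (hγpos y hy).le]
      simp only [_root_.smul_apply, _root_.add_apply, smul_eq_mul]
      field_simp
      ring
    rw [hev.fderiv_eq, (((d1 x hx).hasFDerivAt.fun_mul (key u₂ hu₂ i).hasFDerivAt).fun_sub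
      ((d2 x hx).hasFDerivAt.fun_mul (key u₁ hu₁ i).hasFDerivAt)).fderiv]
    simp only [_root_.smul_apply, _root_.sub_apply,
      _root_.add_apply, smul_eq_mul]
    ring
  rw [Finset.sum_congr rfl (fun i _ => main i), Finset.sum_sub_distrib, ← Finset.mul_sum,
    ← Finset.mul_sum]
  linear_combination u₂ x * e1 - u₁ x * e2
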